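/- arXiv:2002.04130 — 4 statements merged into one kernel-verified Lean document; each statement's English description precedes it below -/
import Mathlib

section
/- Let f : ℝ^n → ℝ be L-Lipschitz and Hadamard directionally differentiable at every point, with directional derivative f'(·;·). Then for any x, y ∈ ℝ^n, setting γ(t) = x + t(y − x), the function t ↦ f'(γ(t); y − x) is Lebesgue integrable on [0,1] and f(y) − f(x) = ∫₀¹ f'(γ(t); y − x) dt. -/
open MeasureTheory

/-- Hadamard directional differentiability. -/
def HadamardDirDiffAt {E F : Type*} [NormedAddCommGroup E] [NormedSpace ℝ E]
    [NormedAddCommGroup F] [NormedSpace ℝ F] (f : E → F) (x : E) (f' : E → F) : Prop :=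
  ∀ (d : E) (φ : ℝ → E), φ 0 = x →
    Filter.Tendsto (fun t => t⁻¹ • (φ t - x)) (nhdsWithin 0 (Set.Ioi 0)) (nhds d) →
    Filter.Tendsto (fun t => t⁻¹ • (f (φ t) - f x)) (nhdsWithin 0 (Set.Ioi 0)) (nhds (f' d))

/-- A Hadamard directionally differentiable function has right derivatives along lines. -/
lemma HadamardDirDiffAt.hasDerivWithinAt_line {E F : Type*} [NormedAddCommGroup E]
    [NormedSpace ℝ E] [NormedAddCommGroup F] [NormedSpace ℝ F] {f : E → F} {f' : E → F}
    {x v : E} {s : ℝ} (h : HadamardDirDiffAt f (x + s • v) f') :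
    HasDerivWithinAt (fun t : ℝ => f (x + t • v)) (f' v) (Set.Ioi s) s := by
  have hlim := h v (fun t => x + (s + t) • v) (by simp) (by
    refine tendsto_const_nhds.congr' ?_
    filter_upwards [self_mem_nhdsWithin] with t ht
    have ht0 : t ≠ 0 := ne_of_gt ht
    rw [add_smul, ← add_assoc, add_sub_cancel_left, smul_smul, inv_mul_cancel₀ ht0, one_smul])
  rw [hasDerivWithinAt_iff_tendsto_slope' Set.self_notMem_Ioi]
  have hshift : Filter.Tendsto (fun t : ℝ => t - s) (nhdsWithin s (Set.Ioi s))
      (nhdsWithin 0 (Set.Ioi 0)) := by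
    refine tendsto_nhdsWithin_of_tendsto_nhds_of_eventually_within _ ?_ ?_
    · have hc : Continuous fun t : ℝ => t - s := by fun_prop
      simpa using (hc.tendsto s).mono_left nhdsWithin_le_nhds
    · filter_upwards [self_mem_nhdsWithin] with t ht
      exact sub_pos.2 (Set.mem_Ioi.1 ht)
  refine (hlim.comp hshift).congr fun t => ?_
  simp [slope]

/-- A right derivative of a Lipschitz function is bounded by the Lipschitz constant. -/
lemma LipschitzWith.norm_le_of_hasDerivWithinAt_Ioi {F : Type*} [NormedAddCommGroup F]
    [NormedSpace ℝ F] {g : ℝ → F} {K : NNReal} (hg : LipschitzWith K g) {a : F} {s : ℝ}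
    (h : HasDerivWithinAt g a (Set.Ioi s) s) : ‖a‖ ≤ K := by
  rw [hasDerivWithinAt_iff_tendsto_slope' Set.self_notMem_Ioi] at h
  refine le_of_tendsto h.norm ?_
  filter_upwards [self_mem_nhdsWithin] with t ht
  have hpos : 0 < t - s := sub_pos.2 ht
  have hle := hg.dist_le_mul t s
  rw [dist_eq_norm, Real.dist_eq, abs_of_pos hpos] at hle
  rw [slope, vsub_eq_sub, norm_smul, norm_inv, Real.norm_eq_abs, abs_of_pos hpos,
    inv_mul_le_iff₀ hpos]
  linarith

/-- Path-integral representation of increments of a Lipschitz, Hadamard directionally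
differentiable function: `f y - f x = ∫₀¹ f'(x + t(y-x); y - x) dt`, and the integrand
is Lebesgue integrable on `[0,1]`. -/
theorem lebesgue_path_integral {n : ℕ} (f : EuclideanSpace ℝ (Fin n) → ℝ) (L : ℝ)
    (f' : EuclideanSpace ℝ (Fin n) → EuclideanSpace ℝ (Fin n) → ℝ)
    (hL : ∀ x y, |f x - f y| ≤ L * ‖x - y‖)
    (hdiff : ∀ x, HadamardDirDiffAt f x (f' x))
    (x y : EuclideanSpace ℝ (Fin n)) :
    IntegrableOn (fun t : ℝ => f' (x + t • (y - x)) (y - x)) (Set.Icc 0 1) ∧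
      f y - f x = ∫ t in Set.Icc (0:ℝ) 1, f' (x + t • (y - x)) (y - x) := by
  have hderiv (t : ℝ) : HasDerivWithinAt (fun s : ℝ => f (x + s • (y - x)))
      (f' (x + t • (y - x)) (y - x)) (Set.Ioi t) t :=
    (hdiff _).hasDerivWithinAt_line
  have hlip : LipschitzWith (L * ‖y - x‖).toNNReal (fun s : ℝ => f (x + s • (y - x))) := by
    refine LipschitzWith.of_dist_le' fun s t => (hL _ _).trans_eq ?_
    rw [add_sub_add_left_eq_sub, ← sub_smul, norm_smul, Real.dist_eq, Real.norm_eq_abs]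
    ring
  have hmeas : Measurable fun t : ℝ => f' (x + t • (y - x)) (y - x) := by
    convert measurable_derivWithin_Ioi (fun s : ℝ => f (x + s • (y - x))) using 2 with t
    exact ((hderiv t).derivWithin (uniqueDiffWithinAt_Ioi t)).symm
  have hint : IntegrableOn (fun t : ℝ => f' (x + t • (y - x)) (y - x)) (Set.Icc 0 1) :=
    IntegrableOn.of_bound (by simp) hmeas.aestronglyMeasurable _
      (.of_forall fun t => hlip.norm_le_of_hasDerivWithinAt_Ioi (hderiv t))
  refine ⟨hint, ?_⟩
  have hFTC := intervalIntegral.integral_eq_sub_of_hasDeriv_right_of_le_real zero_le_one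
    hlip.continuous.continuousOn (fun t _ => hderiv t) hint
  rw [integral_Icc_eq_integral_Ioc, ← intervalIntegral.integral_of_le zero_le_one, hFTC]
  simp
end

section
/- Let L > 0, Δ > 0, let x₁ < x₂ < ... < x_K be finitely many real numbers, let 0 ≤ ε < L, and let θ₁, θ₂ ∈ (0, 1/2) with θ₁ ≠ θ₂. Then there exist functions f₁, f₂ : ℝ → ℝ, each L-Lipschitz and Hadamard directionally differentiable at every point, such that for i = 1, 2 and every k: f_i(x_k) = 0, f_i is differentiable at x_k with derivative f_i'(x_k) = L, f_i(x₁) − inf_x f_i(x) ≤ Δ, and the ε-stationary sets are disjoint: {x : ∃ g ∈ ∂f₁(x), |g| ≤ ε} ∩ {x : ∃ g ∈ ∂f₂(x), |g| ≤ ε} = ∅. -/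
/-- The Clarke generalized directional derivative for `f : ℝ → ℝ`. -/
noncomputable def clarkeDirDeriv1 (f : ℝ → ℝ) (x d : ℝ) : ℝ :=
  Filter.limsup (fun p : ℝ × ℝ => (f (p.1 + p.2 * d) - f p.1) / p.2)
    ((nhds x) ×ˢ (nhdsWithin 0 (Set.Ioi 0)))

/-- The Clarke generalized gradient for `f : ℝ → ℝ`. -/
noncomputable def clarkeSubdiff1 (f : ℝ → ℝ) (x : ℝ) : Set ℝ :=
  {g | ∀ d, g * d ≤ clarkeDirDeriv1 f x d}

open Filter Topology

namespace HadamardDirDiffAt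

variable {E : Type*} [NormedAddCommGroup E] [NormedSpace ℝ E]

theorem neg {f : E → ℝ} {z : E} {D : E → ℝ} (h : HadamardDirDiffAt f z D) :
    HadamardDirDiffAt (fun y => -f y) z (fun d => -D d) := by
  intro d φ h0 hφ
  refine (h d φ h0 hφ).neg.congr fun t => ?_
  simp only [smul_eq_mul]
  ring

theorem const_mul_add {f : E → ℝ} {z : E} {D : E → ℝ} (h : HadamardDirDiffAt f z D) (L c : ℝ) :
    HadamardDirDiffAt (fun y => L * f y + c) z (fun d => L * D d) := by
  intro d φ h0 hφ
  refine ((h d φ h0 hφ).const_mul L).congr fun t => ?_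
  simp only [smul_eq_mul]
  ring

theorem tendsto_curve {z d : E} {φ : ℝ → E}
    (hφ : Tendsto (fun t => t⁻¹ • (φ t - z)) (𝓝[>] 0) (𝓝 d)) :
    Tendsto φ (𝓝[>] 0) (𝓝 z) := by
  have hid : Tendsto (fun t : ℝ => t) (𝓝[>] 0) (𝓝 0) := nhdsWithin_le_nhds
  have h := (hid.smul hφ).add_const z
  rw [zero_smul, zero_add] at h
  refine h.congr' ?_
  filter_upwards [self_mem_nhdsWithin] with t ht
  rw [smul_inv_smul₀ (ne_of_gt ht), sub_add_cancel]

theorem congr_of_eventuallyEq {f g : E → ℝ} {z : E} {D : E → ℝ} (h : HadamardDirDiffAt f z D)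
    (hfg : g =ᶠ[𝓝 z] f) : HadamardDirDiffAt g z D := by
  intro d φ h0 hφ
  refine (h d φ h0 hφ).congr' ?_
  filter_upwards [(tendsto_curve hφ).eventually hfg] with t ht
  rw [ht, hfg.eq_of_nhds]

theorem inf_of_eq {f g : E → ℝ} {z : E} {D D' : E → ℝ} (hf : HadamardDirDiffAt f z D)
    (hg : HadamardDirDiffAt g z D') (hfg : f z = g z) :
    HadamardDirDiffAt (f ⊓ g) z (D ⊓ D') := by
  intro d φ h0 hφ
  refine ((hf d φ h0 hφ).min (hg d φ h0 hφ)).congr' ?_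
  filter_upwards [self_mem_nhdsWithin] with t ht
  have ht' : (0 : ℝ) ≤ t⁻¹ := inv_nonneg.2 (le_of_lt ht)
  simp only [smul_eq_mul, Pi.inf_apply, ← hfg, inf_idem]
  rw [← mul_min_of_nonneg _ _ ht', min_sub_sub_right]

theorem exists_inf {f g : E → ℝ} {z : E} (hf : ∃ D, HadamardDirDiffAt f z D)
    (hg : ∃ D, HadamardDirDiffAt g z D) (cf : ContinuousAt f z) (cg : ContinuousAt g z) :
    ∃ D, HadamardDirDiffAt (f ⊓ g) z D := by
  obtain ⟨D, hf⟩ := hf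
  obtain ⟨D', hg⟩ := hg
  rcases lt_trichotomy (f z) (g z) with h | h | h
  · refine ⟨D, hf.congr_of_eventuallyEq ?_⟩
    filter_upwards [cf.eventually_lt cg h] with y hy
    exact inf_of_le_left hy.le
  · exact ⟨_, hf.inf_of_eq hg h⟩
  · refine ⟨D', hg.congr_of_eventuallyEq ?_⟩
    filter_upwards [cg.eventually_lt cf h] with y hy
    exact inf_of_le_right hy.le

theorem sub_const (c z : ℝ) : HadamardDirDiffAt (fun y : ℝ => y - c) z id := by
  intro d φ _ hφ
  simpa using hφ

theorem exists_abs_sub (c z : ℝ) : ∃ D, HadamardDirDiffAt (fun y : ℝ => |y - c|) z D := by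
  obtain ⟨D, hD⟩ := exists_inf ⟨_, sub_const c z⟩ ⟨_, (sub_const c z).neg⟩
    (by fun_prop) (by fun_prop)
  refine ⟨_, hD.neg.congr_of_eventuallyEq (Eventually.of_forall fun y => ?_)⟩
  simp only [Pi.inf_apply, abs, neg_inf, neg_neg]
  exact sup_comm _ _

end HadamardDirDiffAt

theorem clarkeDirDeriv1_of_eventuallyEq_affine {f : ℝ → ℝ} {z s c : ℝ}
    (h : f =ᶠ[𝓝 z] fun y => s * y + c) (d : ℝ) : clarkeDirDeriv1 f z d = s * d := by
  have hid : Tendsto (fun t : ℝ => t) (𝓝[>] 0) (𝓝 0) := nhdsWithin_le_nhds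
  have hfst : Tendsto (fun p : ℝ × ℝ => p.1) (𝓝 z ×ˢ 𝓝[>] 0) (𝓝 z) := tendsto_fst
  have hsnd : Tendsto (fun p : ℝ × ℝ => p.2) (𝓝 z ×ˢ 𝓝[>] 0) (𝓝 0) := hid.comp tendsto_snd
  have hmove : Tendsto (fun p : ℝ × ℝ => p.1 + p.2 * d) (𝓝 z ×ˢ 𝓝[>] 0) (𝓝 z) := by
    simpa using hfst.add (hsnd.mul_const d)
  have hpos : ∀ᶠ p : ℝ × ℝ in 𝓝 z ×ˢ 𝓝[>] 0, 0 < p.2 :=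
    tendsto_snd.eventually (self_mem_nhdsWithin : Set.Ioi (0 : ℝ) ∈ 𝓝[>] 0)
  have key : (fun p : ℝ × ℝ => (f (p.1 + p.2 * d) - f p.1) / p.2)
      =ᶠ[𝓝 z ×ˢ 𝓝[>] 0] fun _ => s * d := by
    filter_upwards [hfst.eventually h, hmove.eventually h, hpos] with p h1 h2 h3
    rw [h1, h2]
    field_simp
    ring
  rw [clarkeDirDeriv1, limsup_congr key, limsup_const]

theorem eq_of_mem_clarkeSubdiff1_of_eventuallyEq_affine {f : ℝ → ℝ} {z s c g : ℝ}
    (h : f =ᶠ[𝓝 z] fun y => s * y + c) (hg : g ∈ clarkeSubdiff1 f z) : g = s := by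
  have h1 := hg 1
  have h2 := hg (-1)
  rw [clarkeDirDeriv1_of_eventuallyEq_affine h] at h1 h2
  linarith

/-- The function `z ↦ L * (dist (z + a, range x) - a)`. -/
noncomputable def zigzag {ι : Type*} [Fintype ι] [Nonempty ι] (L a : ℝ) (x : ι → ℝ) : ℝ → ℝ :=
  Finset.univ.inf' Finset.univ_nonempty fun i z => L * (|z + a - x i| - a)

namespace zigzag

variable {ι : Type*} [Fintype ι] [Nonempty ι] {L a : ℝ} {x : ι → ℝ}

theorem apply_eq (L a : ℝ) (x : ι → ℝ) (z : ℝ) :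
    zigzag L a x z =
      Finset.univ.inf' Finset.univ_nonempty fun i => L * (|z + a - x i| - a) :=
  Finset.inf'_apply _ _ _

theorem lipschitz_and_hadamardDirDiffAt (hL : 0 < L) (a : ℝ) (x : ι → ℝ) :
    (∀ y z, |zigzag L a x y - zigzag L a x z| ≤ L * |y - z|) ∧
      ∀ z, ∃ D, HadamardDirDiffAt (zigzag L a x) z D := by
  have cont : ∀ f : ℝ → ℝ, (∀ y z, |f y - f z| ≤ L * |y - z|) → Continuous f := fun f hf =>
    (LipschitzWith.of_dist_le_mul (K := ⟨L, hL.le⟩) fun y z => by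
      rw [Real.dist_eq, Real.dist_eq]
      exact hf y z).continuous
  refine Finset.inf'_induction
    (p := fun f : ℝ → ℝ => (∀ y z, |f y - f z| ≤ L * |y - z|) ∧ ∀ z, ∃ D, HadamardDirDiffAt f z D)
    _ _ ?_ ?_
  · rintro f ⟨hf, hf'⟩ g ⟨hg, hg'⟩
    exact ⟨fun y z => (abs_min_sub_min_le_max _ _ _ _).trans (max_le (hf y z) (hg y z)),
      fun z => HadamardDirDiffAt.exists_inf (hf' z) (hg' z) (cont f hf).continuousAt
        (cont g hg).continuousAt⟩
  · intro i _
    refine ⟨fun y z => ?_, fun z => ?_⟩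
    · rw [← mul_sub, abs_mul, abs_of_pos hL]
      refine mul_le_mul_of_nonneg_left ?_ hL.le
      have h := abs_abs_sub_abs_le (y + a - x i) (z + a - x i)
      rw [show y + a - x i - (z + a - x i) = y - z by ring] at h
      rwa [sub_sub_sub_cancel_right]
    · obtain ⟨D, hD⟩ := HadamardDirDiffAt.exists_abs_sub (x i - a) z
      refine ⟨_, (hD.const_mul_add L (-(L * a))).congr_of_eventuallyEq
        (Eventually.of_forall fun y => ?_)⟩
      simp only [show y - (x i - a) = y + a - x i by ring]
      ring

theorem eventuallyEq_of_nearest (hL : 0 < L) {z : ℝ} {k : ι}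
    (hk : ∀ i, i ≠ k → |z + a - x k| < |z + a - x i|) :
    zigzag L a x =ᶠ[𝓝 z] fun y => L * (|y + a - x k| - a) := by
  have h : ∀ᶠ y in 𝓝 z, ∀ i, |y + a - x k| ≤ |y + a - x i| := by
    refine eventually_all.2 fun i => ?_
    rcases eq_or_ne i k with rfl | hi
    · simp
    · have ck : ContinuousAt (fun y => |y + a - x k|) z := by fun_prop
      have ci : ContinuousAt (fun y => |y + a - x i|) z := by fun_prop
      exact (ck.eventually_lt ci (hk i hi)).mono fun y hy => hy.le
  filter_upwards [h] with y hy
  rw [apply_eq]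
  refine le_antisymm (Finset.inf'_le _ (Finset.mem_univ k)) (Finset.le_inf' _ _ fun i _ => ?_)
  exact mul_le_mul_of_nonneg_left (sub_le_sub_right (hy i) a) hL.le

theorem eventuallyEq_affine_of_nearest_left (hL : 0 < L) {z : ℝ} {k : ι}
    (hk : ∀ i, i ≠ k → |z + a - x k| < |z + a - x i|) (hz : x k < z + a) :
    zigzag L a x =ᶠ[𝓝 z] fun y => L * y + -(L * x k) := by
  have h : ∀ᶠ y in 𝓝 z, x k - a < y := eventually_gt_nhds (by linarith)
  filter_upwards [eventuallyEq_of_nearest hL hk, h] with y hy hy'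
  rw [hy, abs_of_pos (by linarith)]
  ring

theorem eventuallyEq_affine_of_nearest_right (hL : 0 < L) {z : ℝ} {k : ι}
    (hk : ∀ i, i ≠ k → |z + a - x k| < |z + a - x i|) (hz : z + a < x k) :
    zigzag L a x =ᶠ[𝓝 z] fun y => -L * y + L * (x k - 2 * a) := by
  have h : ∀ᶠ y in 𝓝 z, y < x k - a := eventually_lt_nhds (by linarith)
  filter_upwards [eventuallyEq_of_nearest hL hk, h] with y hy hy'
  rw [hy, abs_of_neg (by linarith)]
  ring

theorem abs_eq_of_mem_clarkeSubdiff1 (hL : 0 < L) (hx : Function.Injective x) {z g : ℝ}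
    (hz : ∀ i j, z + a ≠ (x i + x j) / 2) (hg : g ∈ clarkeSubdiff1 (zigzag L a x) z) :
    |g| = L := by
  obtain ⟨k, hk⟩ := Finite.exists_min fun i => |z + a - x i|
  have hk' : ∀ i, i ≠ k → |z + a - x k| < |z + a - x i| := fun i hi =>
    lt_of_le_of_ne (hk i) fun h => by
      rcases abs_eq_abs.1 h with h | h
      · exact hi (hx (by linarith))
      · exact hz i k (by linarith)
  rcases lt_or_gt_of_ne (hz k k) with h | h
  · rw [eq_of_mem_clarkeSubdiff1_of_eventuallyEq_affine
      (eventuallyEq_affine_of_nearest_right hL hk' (by linarith)) hg, abs_neg, abs_of_pos hL]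
  · rw [eq_of_mem_clarkeSubdiff1_of_eventuallyEq_affine
      (eventuallyEq_affine_of_nearest_left hL hk' (by linarith)) hg, abs_of_pos hL]

theorem eventuallyEq_affine_at (hL : 0 < L) (ha : 0 < a)
    (hsep : ∀ i j, i ≠ j → 2 * a < |x i - x j|) (k : ι) :
    zigzag L a x =ᶠ[𝓝 (x k)] fun y => L * y + -(L * x k) := by
  refine eventuallyEq_affine_of_nearest_left hL (fun i hi => ?_) (by linarith)
  have h := hsep k i hi.symm
  rw [add_sub_cancel_left, abs_of_pos ha]
  rw [lt_abs] at h ⊢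
  rcases h with h | h
  · left; linarith
  · right; linarith

theorem apply_query (hL : 0 < L) (ha : 0 < a)
    (hsep : ∀ i j, i ≠ j → 2 * a < |x i - x j|) (k : ι) : zigzag L a x (x k) = 0 := by
  rw [(eventuallyEq_affine_at hL ha hsep k).eq_of_nhds, add_neg_cancel]

theorem hasDerivAt_query (hL : 0 < L) (ha : 0 < a)
    (hsep : ∀ i j, i ≠ j → 2 * a < |x i - x j|) (k : ι) :
    HasDerivAt (zigzag L a x) L (x k) := by
  refine HasDerivAt.congr_of_eventuallyEq ?_ (eventuallyEq_affine_at hL ha hsep k)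
  simpa using ((hasDerivAt_id (x k)).const_mul L).add_const (-(L * x k))

theorem neg_mul_le (hL : 0 < L) (a : ℝ) (x : ι → ℝ) (z : ℝ) : -(L * a) ≤ zigzag L a x z := by
  rw [apply_eq]
  refine Finset.le_inf' _ _ fun i _ => ?_
  nlinarith [mul_nonneg hL.le (abs_nonneg (z + a - x i))]

end zigzag

theorem eventually_pos_and_mul_le_and_separated {ι : Type*} [Finite ι] {x : ι → ℝ}
    (hx : Function.Injective x) {Δ : ℝ} (hΔ : 0 < Δ) (L : ℝ) {θ : ℝ} (hθ : 0 < θ) :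
    ∀ᶠ t in 𝓝[>] (0 : ℝ), 0 < θ * t ∧ L * (θ * t) ≤ Δ ∧
      ∀ i j, i ≠ j → 2 * (θ * t) < |x i - x j| := by
  have small : ∀ c b : ℝ, 0 < b → ∀ᶠ t in 𝓝[>] (0 : ℝ), c * (θ * t) < b := fun c b hb =>
    nhdsWithin_le_nhds (ContinuousAt.eventually_lt (by fun_prop) continuousAt_const
      (by simpa using hb))
  have sep : ∀ᶠ t in 𝓝[>] (0 : ℝ), ∀ i j, i ≠ j → 2 * (θ * t) < |x i - x j| := by
    refine eventually_all.2 fun i => eventually_all.2 fun j => ?_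
    rcases eq_or_ne i j with h | h
    · simp [h]
    · filter_upwards [small 2 _ (abs_pos.2 (sub_ne_zero.2 (hx.ne h)))] with t ht _ using ht
  filter_upwards [self_mem_nhdsWithin, small L Δ hΔ, sep] with t h1 h2 h3
  exact ⟨mul_pos hθ h1, h2.le, h3⟩

theorem eventually_mul_ne {c : ℝ} (hc : c ≠ 0) (p : ℝ) : ∀ᶠ t in 𝓝[>] (0 : ℝ), c * t ≠ p := by
  rcases eq_or_ne p 0 with rfl | hp
  · filter_upwards [self_mem_nhdsWithin] with t ht using mul_ne_zero hc (ne_of_gt ht)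
  · refine nhdsWithin_le_nhds (ContinuousAt.eventually_ne (by fun_prop) ?_)
    simpa using hp.symm

/-- Resisting-oracle construction: given finitely many query points there exist two
`L`-Lipschitz, everywhere Hadamard directionally differentiable functions vanishing at all
the query points with derivative `L` there, bounded suboptimality `Δ`, whose sets of
`ε`-stationary points are disjoint. -/
theorem resisting_functions_exist (L Δ : ℝ) (hL : 0 < L) (hΔ : 0 < Δ)
    (K : ℕ) (hK : 0 < K) (x : Fin K → ℝ) (hx : StrictMono x)
    (ε : ℝ) (hε0 : 0 ≤ ε) (hεL : ε < L)
    (θ₁ θ₂ : ℝ) (hθ₁ : θ₁ ∈ Set.Ioo (0:ℝ) (1/2)) (hθ₂ : θ₂ ∈ Set.Ioo (0:ℝ) (1/2))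
    (hθ : θ₁ ≠ θ₂) :
    ∃ f₁ f₂ : ℝ → ℝ,
      (∀ a b, |f₁ a - f₁ b| ≤ L * |a - b|) ∧ (∀ a b, |f₂ a - f₂ b| ≤ L * |a - b|) ∧
      (∀ z : ℝ, ∃ D : ℝ → ℝ, HadamardDirDiffAt f₁ z D) ∧
      (∀ z : ℝ, ∃ D : ℝ → ℝ, HadamardDirDiffAt f₂ z D) ∧
      (∀ k, f₁ (x k) = 0) ∧ (∀ k, f₂ (x k) = 0) ∧
      (∀ k, HasDerivAt f₁ L (x k)) ∧ (∀ k, HasDerivAt f₂ L (x k)) ∧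
      (∀ z : ℝ, f₁ (x ⟨0, hK⟩) - f₁ z ≤ Δ) ∧ (∀ z : ℝ, f₂ (x ⟨0, hK⟩) - f₂ z ≤ Δ) ∧
      {y : ℝ | ∃ g ∈ clarkeSubdiff1 f₁ y, |g| ≤ ε} ∩
        {y : ℝ | ∃ g ∈ clarkeSubdiff1 f₂ y, |g| ≤ ε} = ∅ := by
  have : Nonempty (Fin K) := ⟨⟨0, hK⟩⟩
  have hne : ∀ᶠ t in 𝓝[>] (0 : ℝ), ∀ i j k l,
      (θ₁ - θ₂) * t ≠ (x i + x j) / 2 - (x k + x l) / 2 := by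
    simp only [eventually_all]
    exact fun i j k l => eventually_mul_ne (sub_ne_zero.2 hθ) _
  obtain ⟨t, ⟨ha, haΔ, ha_sep⟩, ⟨hb, hbΔ, hb_sep⟩, hne⟩ :=
    ((eventually_pos_and_mul_le_and_separated hx.injective hΔ L hθ₁.1).and
      ((eventually_pos_and_mul_le_and_separated hx.injective hΔ L hθ₂.1).and hne)).exists
  obtain ⟨hlip₁, hdir₁⟩ := zigzag.lipschitz_and_hadamardDirDiffAt hL (θ₁ * t) x
  obtain ⟨hlip₂, hdir₂⟩ := zigzag.lipschitz_and_hadamardDirDiffAt hL (θ₂ * t) x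
  refine ⟨zigzag L (θ₁ * t) x, zigzag L (θ₂ * t) x, hlip₁, hlip₂, hdir₁, hdir₂,
    zigzag.apply_query hL ha ha_sep, zigzag.apply_query hL hb hb_sep,
    zigzag.hasDerivAt_query hL ha ha_sep, zigzag.hasDerivAt_query hL hb hb_sep,
    fun z => ?_, fun z => ?_, ?_⟩
  · rw [zigzag.apply_query hL ha ha_sep]
    linarith [zigzag.neg_mul_le hL (θ₁ * t) x z]
  · rw [zigzag.apply_query hL hb hb_sep]
    linarith [zigzag.neg_mul_le hL (θ₂ * t) x z]
  · refine Set.eq_empty_of_forall_notMem ?_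
    rintro y ⟨⟨g₁, hg₁, hε₁⟩, g₂, hg₂, hε₂⟩
    have kink : ∀ a g : ℝ, g ∈ clarkeSubdiff1 (zigzag L a x) y → |g| ≤ ε →
        ∃ i j, y + a = (x i + x j) / 2 := by
      intro a g hg hgε
      by_contra! h
      linarith [zigzag.abs_eq_of_mem_clarkeSubdiff1 hL hx.injective h hg]
    obtain ⟨i, j, hij⟩ := kink _ _ hg₁ hε₁
    obtain ⟨k, l, hkl⟩ := kink _ _ hg₂ hε₂
    exact hne i j k l (by linarith)
end

section
/- Let δ > 0 and let x₁ < x₂ < ... < x_K be finitely many real numbers. Then there exist functions f₁, f₂ : ℝ → ℝ, each 1-Lipschitz and Hadamard directionally differentiable at every point, such that for i = 1, 2 and every k: f_i is differentiable at x_k with derivative f_i'(x_k) = 1, sup_k f_i(x_k) − inf_x f_i(x) ≤ 8δK, and for every ε ∈ [0, 1), every ε-stationary point y₁ of f₁ (i.e. some g ∈ ∂f₁(y₁) has |g| ≤ ε) and every ε-stationary point y₂ of f₂ satisfy |y₁ − y₂| > δ. -/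
open Filter Topology Set

/-- `f` is affine with slope `σ m` on each interval `[l + w * m, l + w * (m + 1)]`. -/
def IsZigzag (f : ℝ → ℝ) (l w : ℝ) (σ : ℤ → ℝ) : Prop :=
  ∀ m : ℤ, ∀ z ∈ Icc (l + w * m) (l + w * (m + 1)),
    f z = f (l + w * m) + σ m * (z - (l + w * m))

/-- Near `y`, `f` is affine with slope `a` to the right of `y` and slope `b` to the left. -/
def HasSlopesAt (f : ℝ → ℝ) (a b y : ℝ) : Prop :=
  ∀ᶠ z in 𝓝 y, f z = f y + (a * max (z - y) 0 + b * min (z - y) 0)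

theorem exists_grid_cell (l : ℝ) {w : ℝ} (hw : 0 < w) (y : ℝ) :
    ∃ m : ℤ, l + w * m ≤ y ∧ y < l + w * (m + 1) := by
  refine ⟨⌊(y - l) / w⌋, ?_, ?_⟩
  · have := (le_div_iff₀ hw).1 (Int.floor_le ((y - l) / w))
    linarith
  · have := (div_lt_iff₀ hw).1 (Int.lt_floor_add_one ((y - l) / w))
    linarith

theorem IsZigzag.hasSlopesAt_of_mem_Ioo {f : ℝ → ℝ} {l w : ℝ} {σ : ℤ → ℝ}
    (hf : IsZigzag f l w σ) {m : ℤ} {y : ℝ} (hy : y ∈ Ioo (l + w * m) (l + w * (m + 1))) :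
    HasSlopesAt f (σ m) (σ m) y := by
  filter_upwards [Ioo_mem_nhds hy.1 hy.2] with z hz
  rw [hf m z (Ioo_subset_Icc_self hz), hf m y (Ioo_subset_Icc_self hy), ← mul_add, max_add_min]
  ring

theorem IsZigzag.hasSlopesAt_grid {f : ℝ → ℝ} {l w : ℝ} {σ : ℤ → ℝ}
    (hf : IsZigzag f l w σ) (hw : 0 < w) (m : ℤ) :
    HasSlopesAt f (σ m) (σ (m - 1)) (l + w * m) := by
  filter_upwards [Ioo_mem_nhds (show l + w * (m - 1) < l + w * m by linarith)
    (show l + w * m < l + w * (m + 1) by linarith)] with z hz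
  rcases le_total (l + w * m) z with h | h
  · rw [max_eq_left (by linarith), min_eq_right (by linarith), hf m z ⟨h, hz.2.le⟩]
    ring
  · have key := hf (m - 1)
    push_cast at key
    rw [sub_add_cancel] at key
    rw [max_eq_right (by linarith), min_eq_left (by linarith), key z ⟨hz.1.le, h⟩,
      key (l + w * m) ⟨by linarith, le_rfl⟩]
    ring

theorem IsZigzag.exists_hasSlopesAt {f : ℝ → ℝ} {l w : ℝ} {σ : ℤ → ℝ}
    (hf : IsZigzag f l w σ) (hw : 0 < w) (y : ℝ) :
    ∃ m n : ℤ, HasSlopesAt f (σ m) (σ n) y ∧ y ∈ Icc (l + w * m) (l + w * (m + 1)) ∧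
      y ∈ Icc (l + w * n) (l + w * (n + 1)) ∧ ((∀ i : ℤ, y ≠ l + w * i) → m = n) := by
  obtain ⟨m, h1, h2⟩ := exists_grid_cell l hw y
  rcases h1.eq_or_lt with h | h
  · refine ⟨m, m - 1, h ▸ hf.hasSlopesAt_grid hw m, ⟨h1, h2.le⟩, ?_, fun hi => (hi m h.symm).elim⟩
    push_cast
    constructor <;> linarith
  · exact ⟨m, m, hf.hasSlopesAt_of_mem_Ioo ⟨h, h2⟩, ⟨h1, h2.le⟩, ⟨h1, h2.le⟩, fun _ => rfl⟩

theorem HasSlopesAt.continuousAt {f : ℝ → ℝ} {a b y : ℝ} (h : HasSlopesAt f a b y) :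
    ContinuousAt f y := by
  refine ContinuousAt.congr_of_eventuallyEq ?_ h
  fun_prop

theorem HasSlopesAt.hasDerivWithinAt_Ici {f : ℝ → ℝ} {a b y : ℝ} (h : HasSlopesAt f a b y) :
    HasDerivWithinAt f a (Ici y) y := by
  have hlin : HasDerivWithinAt (fun z => f y + a * (z - y)) a (Ici y) y := by
    simpa using ((((hasDerivAt_id y).sub_const y).const_mul a).const_add (f y)).hasDerivWithinAt
  refine hlin.congr_of_eventuallyEq ?_ (by simp)
  filter_upwards [h.filter_mono nhdsWithin_le_nhds, self_mem_nhdsWithin] with z hz hzy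
  rw [hz, max_eq_left (sub_nonneg.2 hzy), min_eq_right (sub_nonneg.2 hzy)]
  ring

theorem HasSlopesAt.eventuallyEq_affine {f : ℝ → ℝ} {a y : ℝ} (h : HasSlopesAt f a a y) :
    ∀ᶠ z in 𝓝 y, f z = f y + a * (z - y) := by
  filter_upwards [h] with z hz
  rw [hz, ← mul_add, max_add_min, add_zero]

theorem HasSlopesAt.hasDerivAt {f : ℝ → ℝ} {a y : ℝ} (h : HasSlopesAt f a a y) :
    HasDerivAt f a y := by
  have hlin : HasDerivAt (fun z => f y + a * (z - y)) a y := by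
    simpa using (((hasDerivAt_id y).sub_const y).const_mul a).const_add (f y)
  exact hlin.congr_of_eventuallyEq h.eventuallyEq_affine

theorem HasSlopesAt.hadamardDirDiffAt {f : ℝ → ℝ} {a b y : ℝ} (h : HasSlopesAt f a b y) :
    HadamardDirDiffAt f y (fun d => a * max d 0 + b * min d 0) := by
  intro d φ _ hφ
  have hid : Tendsto (fun t : ℝ => t) (𝓝[>] 0) (𝓝 0) := tendsto_id.mono_left nhdsWithin_le_nhds
  have hφy : Tendsto φ (𝓝[>] 0) (𝓝 y) := by
    have := (hid.mul hφ).add_const y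
    rw [zero_mul, zero_add] at this
    refine this.congr' ?_
    filter_upwards [self_mem_nhdsWithin] with t ht
    rw [smul_eq_mul, mul_inv_cancel_left₀ (ne_of_gt ht), sub_add_cancel]
  have hcont : Continuous fun q : ℝ => a * max q 0 + b * min q 0 := by fun_prop
  refine ((hcont.tendsto d).comp hφ).congr' ?_
  filter_upwards [hφy.eventually h, self_mem_nhdsWithin] with t ht ht0
  have hpos : 0 ≤ t⁻¹ := inv_nonneg.2 (le_of_lt ht0)
  have hmax := mul_max_of_nonneg (φ t - y) 0 hpos
  have hmin := mul_min_of_nonneg (φ t - y) 0 hpos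
  rw [mul_zero] at hmax hmin
  simp only [Function.comp_apply, smul_eq_mul, ht, ← hmax, ← hmin]
  ring

theorem HasSlopesAt.clarkeDirDeriv1_eq {f : ℝ → ℝ} {a y : ℝ} (h : HasSlopesAt f a a y) (d : ℝ) :
    clarkeDirDeriv1 f y d = a * d := by
  have hshift : Tendsto (fun p : ℝ × ℝ => p.1 + p.2 * d) (𝓝 y ×ˢ 𝓝[>] 0) (𝓝 y) := by
    have hcont : Continuous fun p : ℝ × ℝ => p.1 + p.2 * d := by fun_prop
    have hlim := hcont.tendsto (y, 0)
    rw [zero_mul, add_zero, nhds_prod_eq] at hlim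
    exact hlim.mono_left (prod_mono le_rfl nhdsWithin_le_nhds)
  have hfst : Tendsto (fun p : ℝ × ℝ => p.1) (𝓝 y ×ˢ 𝓝[>] 0) (𝓝 y) := tendsto_fst
  have hsnd : ∀ᶠ p : ℝ × ℝ in 𝓝 y ×ˢ 𝓝[>] 0, 0 < p.2 :=
    tendsto_snd.eventually (self_mem_nhdsWithin : Ioi (0 : ℝ) ∈ 𝓝[>] 0)
  have hquot : (fun p : ℝ × ℝ => (f (p.1 + p.2 * d) - f p.1) / p.2)
      =ᶠ[𝓝 y ×ˢ 𝓝[>] 0] fun _ => a * d := by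
    filter_upwards [hshift.eventually h.eventuallyEq_affine,
      hfst.eventually h.eventuallyEq_affine, hsnd] with p h1 h2 h3
    rw [h1, h2]
    field_simp
    ring
  rw [clarkeDirDeriv1, limsup_congr hquot, limsup_const]

theorem HasSlopesAt.eq_of_mem_clarkeSubdiff1 {f : ℝ → ℝ} {a y g : ℝ} (h : HasSlopesAt f a a y)
    (hg : g ∈ clarkeSubdiff1 f y) : g = a := by
  have h1 := hg 1
  have h2 := hg (-1)
  rw [h.clarkeDirDeriv1_eq] at h1 h2
  linarith

theorem IsZigzag.abs_sub_le {f : ℝ → ℝ} {l w : ℝ} {σ : ℤ → ℝ} (hf : IsZigzag f l w σ)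
    (hw : 0 < w) (hσ : ∀ m, |σ m| = 1) (x y : ℝ) : |f x - f y| ≤ 1 * |x - y| := by
  choose m n hmn _ _ _ using hf.exists_hasSlopesAt hw
  wlog hxy : y ≤ x generalizing x y
  · rw [abs_sub_comm, abs_sub_comm x]
    exact this y x (le_of_not_ge hxy)
  have := norm_image_sub_le_of_norm_deriv_right_le_segment (f := f) (a := y) (b := x) (C := 1)
    (fun z _ => (hmn z).continuousAt.continuousWithinAt)
    (fun z _ => (hmn z).hasDerivWithinAt_Ici) (fun z _ => (hσ (m z)).le) x ⟨hxy, le_rfl⟩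
  rwa [abs_of_nonneg (sub_nonneg.2 hxy)]

theorem IsZigzag.exists_grid_of_stationary {f : ℝ → ℝ} {l w : ℝ} {σ : ℤ → ℝ}
    (hf : IsZigzag f l w σ) (hw : 0 < w) (hσ : ∀ m, |σ m| = 1) {ε y g : ℝ} (hε : ε < 1)
    (hg : g ∈ clarkeSubdiff1 f y) (hgε : |g| ≤ ε) : ∃ i : ℤ, y = l + w * i := by
  by_contra! hy
  obtain ⟨m, n, h, _, _, hmn⟩ := hf.exists_hasSlopesAt hw y
  obtain rfl := hmn hy
  rw [h.eq_of_mem_clarkeSubdiff1 hg, hσ] at hgε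
  linarith

/-- The sawtooth of period `2`, with slope `-1` on `[2j, 2j+1]` and `1` on `[2j+1, 2j+2]`, modified
to have slope `1` on `[2j, 2j+1]` for `j ∈ B`. -/
noncomputable def raisedSawtooth (B : Finset ℤ) (t : ℝ) : ℝ :=
  |2 * Int.fract (t / 2) - 1| + ∑ j ∈ B, 2 * max 0 (min (t - 2 * j) 1)

/-- The slopes of `raisedSawtooth`. -/
noncomputable def raisedSlope (B : Finset ℤ) (m : ℤ) : ℝ :=
  if m % 2 = 1 ∨ m / 2 ∈ B then 1 else -1

theorem abs_raisedSlope (B : Finset ℤ) (m : ℤ) : |raisedSlope B m| = 1 := by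
  unfold raisedSlope
  split_ifs <;> simp

theorem sawtooth_eq {j : ℤ} {t : ℝ} (h1 : 2 * j ≤ t) (h2 : t ≤ 2 * j + 2) :
    |2 * Int.fract (t / 2) - 1| = |t - 2 * j - 1| := by
  rcases h2.eq_or_lt with rfl | h
  · have : ((2 * j + 2 : ℝ) / 2) = ((j + 1 : ℤ) : ℝ) := by push_cast; ring
    rw [this, Int.fract_intCast]
    ring_nf
    norm_num
  · have : ⌊t / 2⌋ = j := Int.floor_eq_iff.2 ⟨by linarith, by linarith⟩
    rw [Int.fract, this]
    ring_nf

theorem clamp_eq (m j : ℤ) {t : ℝ} (h1 : m ≤ t) (h2 : t ≤ m + 1) :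
    max 0 (min (t - 2 * j) 1) =
      max 0 (min ((m : ℝ) - 2 * j) 1) + if m = 2 * j then t - m else 0 := by
  rcases lt_trichotomy m (2 * j) with h | h | h
  · have : (m : ℝ) + 1 ≤ 2 * j := by exact_mod_cast h
    rw [if_neg h.ne, max_eq_left (min_le_of_left_le (by linarith)),
      max_eq_left (min_le_of_left_le (by linarith)), add_zero]
  · subst h
    push_cast at h1 h2 ⊢
    rw [if_pos rfl, min_eq_left (by linarith), max_eq_right (by linarith)]
    simp
  · have : (2 * j : ℝ) + 1 ≤ m := by exact_mod_cast h
    rw [if_neg h.ne', min_eq_right (by linarith), min_eq_right (by linarith), add_zero]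

theorem raisedSawtooth_eq (B : Finset ℤ) (m : ℤ) {t : ℝ} (h1 : m ≤ t) (h2 : t ≤ m + 1) :
    raisedSawtooth B t = raisedSawtooth B m + raisedSlope B m * (t - m) := by
  have hsum : ∑ j ∈ B, 2 * max 0 (min (t - 2 * j) 1) =
      ∑ j ∈ B, 2 * max 0 (min ((m : ℝ) - 2 * j) 1) +
        ∑ j ∈ B, if m = 2 * j then 2 * (t - m) else 0 := by
    rw [← Finset.sum_add_distrib]
    refine Finset.sum_congr rfl fun j _ => ?_
    rw [clamp_eq m j h1 h2]
    split_ifs <;> ring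
  unfold raisedSawtooth raisedSlope
  rw [hsum]
  rcases Int.even_or_odd' m with ⟨i, rfl | rfl⟩
  · have hi : 2 * i / 2 = i := by omega
    have hi' : ∀ j, (2 * i = 2 * j ↔ i = j) := by omega
    push_cast at h1 h2 ⊢
    simp only [hi', Finset.sum_ite_eq, Int.mul_emod_right, hi]
    rw [sawtooth_eq h1 (by linarith), sawtooth_eq (j := i) le_rfl (by linarith),
      abs_of_nonpos (by linarith), abs_of_nonpos (by linarith)]
    norm_num
    split_ifs <;> ring
  · have hi : ∀ j, ¬ 2 * i + 1 = 2 * j := by omega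
    push_cast at h1 h2 ⊢
    simp only [hi, if_false, Finset.sum_const_zero]
    rw [if_pos (by omega), sawtooth_eq (j := i) (by linarith) (by linarith),
      sawtooth_eq (j := i) (by linarith) (by linarith),
      abs_of_nonneg (by linarith), abs_of_nonneg (by linarith)]
    ring

theorem raisedSawtooth_nonneg (B : Finset ℤ) (t : ℝ) : 0 ≤ raisedSawtooth B t := by
  unfold raisedSawtooth
  positivity

theorem raisedSawtooth_le (B : Finset ℤ) (t : ℝ) : raisedSawtooth B t ≤ 1 + 2 * B.card := by
  have h1 : |2 * Int.fract (t / 2) - 1| ≤ 1 := by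
    rw [abs_le]
    constructor <;> linarith [Int.fract_nonneg (t / 2), Int.fract_lt_one (t / 2)]
  have h2 : ∑ j ∈ B, 2 * max 0 (min (t - 2 * j) 1) ≤ B.card • (2 : ℝ) :=
    Finset.sum_le_card_nsmul _ _ _ fun j _ => by
      linarith [max_le zero_le_one (min_le_right (t - 2 * j) (1 : ℝ))]
  rw [nsmul_eq_mul] at h2
  unfold raisedSawtooth
  linarith

theorem isZigzag_raisedSawtooth (B : Finset ℤ) (l : ℝ) {w : ℝ} (hw : 0 < w) :
    IsZigzag (fun z => w * raisedSawtooth B ((z - l) / w)) l w (raisedSlope B) := by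
  intro m z hz
  have h1 : (m : ℝ) ≤ (z - l) / w := by
    rw [le_div_iff₀ hw]
    linarith [hz.1]
  have h2 : (z - l) / w ≤ m + 1 := by
    rw [div_le_iff₀ hw]
    linarith [hz.2]
  have h3 : (l + w * m - l) / w = m := by
    field_simp
    ring
  simp only [h3]
  rw [raisedSawtooth_eq B m h1 h2]
  field_simp
  ring

/-- For every grid `l + wℤ` there is a zigzag function on it which increases at all query points and
whose oscillation is at most `w * (1 + 2 * K)`. -/
theorem exists_zigzag_increasing_at {K : ℕ} (x : Fin K → ℝ) (l : ℝ) {w : ℝ} (hw : 0 < w) :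
    ∃ (f : ℝ → ℝ) (σ : ℤ → ℝ), IsZigzag f l w σ ∧ (∀ m, |σ m| = 1) ∧
      (∀ k, HasDerivAt f 1 (x k)) ∧ ∀ y z, f y - f z ≤ w * (1 + 2 * K) := by
  let B : Finset ℤ := Finset.univ.image fun k => ⌊(x k - l) / w / 2⌋
  have hzig := isZigzag_raisedSawtooth B l hw
  refine ⟨_, _, hzig, abs_raisedSlope B, fun k => ?_, fun y z => ?_⟩
  · have hslope : ∀ m : ℤ, x k ∈ Icc (l + w * m) (l + w * (m + 1)) → raisedSlope B m = 1 := by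
      intro m hm
      refine if_pos ?_
      rcases Int.even_or_odd' m with ⟨i, rfl | rfl⟩
      · right
        have hi : 2 * i / 2 = i := by omega
        rw [hi]
        refine Finset.mem_image.2 ⟨k, Finset.mem_univ k, ?_⟩
        obtain ⟨h1, h2⟩ := hm
        push_cast at h1 h2
        rw [Int.floor_eq_iff, le_div_iff₀ two_pos, le_div_iff₀ hw, div_lt_iff₀ two_pos,
          div_lt_iff₀ hw]
        constructor <;> linarith
      · left
        omega
    obtain ⟨m, n, h, hm, hn, _⟩ := hzig.exists_hasSlopesAt hw (x k)
    rw [hslope m hm, hslope n hn] at h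
    exact h.hasDerivAt
  · have hcard : (B.card : ℝ) ≤ K := by
      have : B.card ≤ K := Finset.card_image_le.trans_eq (Finset.card_fin K)
      exact_mod_cast this
    simp only [← mul_sub]
    refine mul_le_mul_of_nonneg_left ?_ hw.le
    linarith [raisedSawtooth_le B ((y - l) / w), raisedSawtooth_nonneg B ((z - l) / w)]

/-- Lower-bound construction: given finitely many query points there exist two 1-Lipschitz,
everywhere Hadamard directionally differentiable functions with derivative `1` at every query
point, suboptimality at most `8δK`, and whose `ε`-stationary points (for any `ε ∈ [0,1)`)
are more than `δ` apart. -/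
theorem lower_bound_resisting_functions (δ : ℝ) (hδ : 0 < δ)
    (K : ℕ) (x : Fin K → ℝ) (hx : StrictMono x) :
    ∃ f₁ f₂ : ℝ → ℝ,
      (∀ a b, |f₁ a - f₁ b| ≤ 1 * |a - b|) ∧ (∀ a b, |f₂ a - f₂ b| ≤ 1 * |a - b|) ∧
      (∀ z : ℝ, ∃ D : ℝ → ℝ, HadamardDirDiffAt f₁ z D) ∧
      (∀ z : ℝ, ∃ D : ℝ → ℝ, HadamardDirDiffAt f₂ z D) ∧
      (∀ k, HasDerivAt f₁ 1 (x k)) ∧ (∀ k, HasDerivAt f₂ 1 (x k)) ∧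
      (∀ k, ∀ z : ℝ, f₁ (x k) - f₁ z ≤ 8 * δ * K) ∧
      (∀ k, ∀ z : ℝ, f₂ (x k) - f₂ z ≤ 8 * δ * K) ∧
      (∀ ε : ℝ, 0 ≤ ε → ε < 1 → ∀ y₁ y₂ : ℝ,
        (∃ g ∈ clarkeSubdiff1 f₁ y₁, |g| ≤ ε) →
        (∃ g ∈ clarkeSubdiff1 f₂ y₂, |g| ≤ ε) →
        δ < |y₁ - y₂|) := by
  have hw : 0 < 8 / 3 * δ := by linarith
  obtain ⟨f₁, σ₁, hz₁, hσ₁, hd₁, ho₁⟩ := exists_zigzag_increasing_at x 0 hw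
  obtain ⟨f₂, σ₂, hz₂, hσ₂, hd₂, ho₂⟩ := exists_zigzag_increasing_at x (4 / 3 * δ) hw
  have hK : Fin K → 8 / 3 * δ * (1 + 2 * K) ≤ 8 * δ * K := by
    intro k
    have : (1 : ℝ) ≤ K := by exact_mod_cast k.pos
    nlinarith
  refine ⟨f₁, f₂, hz₁.abs_sub_le hw hσ₁, hz₂.abs_sub_le hw hσ₂, fun z => ?_, fun z => ?_, hd₁, hd₂,
    fun k z => (ho₁ _ _).trans (hK k), fun k z => (ho₂ _ _).trans (hK k), ?_⟩
  · obtain ⟨_, _, h, _⟩ := hz₁.exists_hasSlopesAt hw z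
    exact ⟨_, h.hadamardDirDiffAt⟩
  · obtain ⟨_, _, h, _⟩ := hz₂.exists_hasSlopesAt hw z
    exact ⟨_, h.hadamardDirDiffAt⟩
  · rintro ε - hε y₁ y₂ ⟨g₁, hg₁, hgε₁⟩ ⟨g₂, hg₂, hgε₂⟩
    obtain ⟨i, rfl⟩ := hz₁.exists_grid_of_stationary hw hσ₁ hε hg₁ hgε₁
    obtain ⟨j, rfl⟩ := hz₂.exists_grid_of_stationary hw hσ₂ hε hg₂ hgε₂
    have hodd : (1 : ℝ) ≤ |2 * ((i : ℝ) - j) - 1| := by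
      exact_mod_cast Int.one_le_abs (show 2 * (i - j) - 1 ≠ 0 by omega)
    have hdist : 0 + 8 / 3 * δ * i - (4 / 3 * δ + 8 / 3 * δ * j) =
        4 / 3 * δ * (2 * (i - j) - 1) := by ring
    rw [hdist, abs_mul, abs_of_pos (by linarith)]
    nlinarith
end

section
/- Let E be a real normed vector space, let p > 0, q > 0, β ∈ [0, 1], and let m, g ∈ E. Set m' = β m + (1 − β) g. Then p‖m'‖²(‖m‖ − ‖m'‖) / ((p‖m‖ + q)(p‖m'‖ + q)) ≤ (1 − β)·‖m'‖²/(p‖m'‖ + q) + ((1 − β) p ‖g‖ / q) · ‖m‖²/(p‖m‖ + q). -/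
/-- Telescoping inequality for the adaptive step size `η = 1/(p‖m‖ + q)` with momentum
update `m' = β m + (1 - β) g`. -/
theorem adaptive_step_telescope_ineq {E : Type*} [NormedAddCommGroup E] [NormedSpace ℝ E]
    (p q β : ℝ) (hp : 0 < p) (hq : 0 < q) (hβ : β ∈ Set.Icc (0:ℝ) 1)
    (m g m' : E) (hm' : m' = β • m + (1 - β) • g) :
    p * ‖m'‖ ^ 2 * (‖m‖ - ‖m'‖) / ((p * ‖m‖ + q) * (p * ‖m'‖ + q)) ≤
      (1 - β) * (‖m'‖ ^ 2 / (p * ‖m'‖ + q)) +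
        ((1 - β) * p * ‖g‖ / q) * (‖m‖ ^ 2 / (p * ‖m‖ + q)) := by
  obtain ⟨hβ0, hβ1⟩ := hβ
  have ht : 0 ≤ 1 - β := sub_nonneg.2 hβ1
  have hdiff : ‖m‖ - ‖m'‖ ≤ (1 - β) * (‖m‖ + ‖g‖) := by
    have h := norm_sub_le m' ((1 - β) • g)
    rw [hm', add_sub_cancel_right, ← hm', norm_smul, norm_smul, Real.norm_of_nonneg hβ0,
      Real.norm_of_nonneg ht] at h
    linarith
  have ha := norm_nonneg m
  have hb := norm_nonneg m'
  have hc := norm_nonneg g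
  generalize ‖m‖ = a at *
  generalize ‖m'‖ = b at *
  generalize ‖g‖ = c at *
  have hA : 0 < p * a + q := by positivity
  have hB : 0 < p * b + q := by positivity
  rcases le_total a b with hab | hba
  · have hl : p * b ^ 2 * (a - b) / ((p * a + q) * (p * b + q)) ≤ 0 :=
      div_nonpos_of_nonpos_of_nonneg
        (mul_nonpos_of_nonneg_of_nonpos (by positivity) (sub_nonpos.2 hab)) (by positivity)
    exact hl.trans (by positivity)
  · have hsum : (1 - β) * (b ^ 2 / (p * b + q)) +
        ((1 - β) * p * c / q) * (a ^ 2 / (p * a + q)) =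
        (1 - β) * (b ^ 2 * (p * a + q) + p * c * a ^ 2 * ((p * b + q) / q)) /
          ((p * a + q) * (p * b + q)) := by
      field_simp
    rw [hsum]
    refine div_le_div_of_nonneg_right ?_ (by positivity)
    have hone : 1 ≤ (p * b + q) / q := by
      rw [one_le_div hq]
      nlinarith
    have hg : p * c * b ^ 2 ≤ p * c * a ^ 2 * ((p * b + q) / q) :=
      calc p * c * b ^ 2 ≤ p * c * a ^ 2 := by gcongr
        _ ≤ p * c * a ^ 2 * ((p * b + q) / q) := le_mul_of_one_le_right (by positivity) hone
    calc p * b ^ 2 * (a - b) ≤ p * b ^ 2 * ((1 - β) * (a + c)) := by gcongr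
      _ = (1 - β) * (b ^ 2 * (p * a) + p * c * b ^ 2) := by ring
      _ ≤ (1 - β) * (b ^ 2 * (p * a + q) + p * c * a ^ 2 * ((p * b + q) / q)) := by
        gcongr
        linarith
end
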